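/- arXiv:1012.5863 — 2 statements merged into one kernel-verified Lean document; each statement's English description precedes it below -/
import Mathlib

section
/- Let (A,d) be a nonempty compact positive definite metric space and let {A_k} be a sequence of nonempty compact subsets of A such that the Hausdorff distance d_H(A_k, A) tends to 0 as k → ∞. Then |A_k| → |A| as k → ∞ (as elements of [1,∞]). -/
open MeasureTheory Metric
open scoped ENNReal

/-- Integral of a real-valued function against a finite signed Borel measure. -/
noncomputable def sInt {A : Type*} [MeasurableSpace A] (μ : SignedMeasure A) (f : A → ℝ) : ℝ :=
  ∫ x, f x ∂μ.toJordanDecomposition.posPart - ∫ x, f x ∂μ.toJordanDecomposition.negPart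

/-- The bilinear form `Z_A(μ,ν) = ∫∫ e^{-d(x,y)} dμ(x) dν(y)` on finite signed
Borel measures. -/
noncomputable def Zform {A : Type*} [MetricSpace A] [MeasurableSpace A]
    (μ ν : SignedMeasure A) : ℝ :=
  sInt μ (fun x => sInt ν (fun y => Real.exp (-dist x y)))

/-- A metric space is positive definite if every finite subspace has positive
definite similarity matrix `[e^{-d(x,y)}]`. -/
def PosDefSpace (A : Type*) [MetricSpace A] : Prop :=
  ∀ s : Finset A, (Matrix.of fun x y : ↥s => Real.exp (-dist (x : A) (y : A))).PosDef

/-- The magnitude of a compact positive definite metric space, valued in `[1,∞]`. -/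
noncomputable def magnitude (A : Type*) [MetricSpace A] [MeasurableSpace A] : ℝ≥0∞ :=
  ⨆ (μ : SignedMeasure A) (_ : Zform μ μ ≠ 0),
    ENNReal.ofReal ((μ Set.univ) ^ 2 / Zform μ μ)
/-- The magnitude of the subspace `K` of `A`, defined via signed Borel measures
on `A` whose total variation is supported on `K`. -/
noncomputable def magnitudeSet {A : Type*} [MetricSpace A] [MeasurableSpace A]
    (K : Set A) : ℝ≥0∞ :=
  ⨆ (μ : SignedMeasure A) (_ : μ.totalVariation Kᶜ = 0 ∧ Zform μ μ ≠ 0),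
    ENNReal.ofReal ((μ Set.univ) ^ 2 / Zform μ μ)

theorem exists_measurable_near {A : Type*} [MetricSpace A] [CompactSpace A]
    [MeasurableSpace A] [BorelSpace A] (K : Set A) (hne : K.Nonempty) (ε : ℝ)
    (h : ∀ x, ∃ y ∈ K, dist x y < ε) :
    ∃ f : A → A, Measurable f ∧ ∀ x, f x ∈ K ∧ dist (f x) x ≤ ε := by
  classical
  haveI : Nonempty K := hne.to_subtype
  let e : ℕ → A := fun n => (TopologicalSpace.denseSeq K n : A)
  have he : ∀ x, ∃ n, dist x (e n) < ε := by
    intro x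
    obtain ⟨y, hy, hxy⟩ := h x
    have hopen : IsOpen {z : K | dist x (z : A) < ε} :=
      isOpen_lt (by fun_prop) continuous_const
    obtain ⟨z, hz, n, rfl⟩ :=
      (TopologicalSpace.denseRange_denseSeq K).inter_open_nonempty _ hopen ⟨⟨y, hy⟩, hxy⟩
    exact ⟨n, hz⟩
  refine ⟨fun x => e (Nat.find (he x)), ?_, fun x => ⟨Subtype.coe_prop _, ?_⟩⟩
  · exact (measurable_from_nat (f := e)).comp (measurable_find he fun k =>
      (isOpen_lt (by fun_prop) continuous_const).measurableSet)
  · rw [dist_comm]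
    exact (Nat.find_spec (he x)).le

theorem integrable_bdd {A : Type*} [MeasurableSpace A] (p : Measure A) [IsFiniteMeasure p]
    {g : A → ℝ} (hg : Measurable g) {C : ℝ} (hC : ∀ x, |g x| ≤ C) : Integrable g p :=
  Integrable.of_bound hg.aestronglyMeasurable C (Filter.Eventually.of_forall hC)

theorem sInt_sub_eq {A : Type*} [MeasurableSpace A] (p n : Measure A) [IsFiniteMeasure p]
    [IsFiniteMeasure n] {g : A → ℝ} (hg : Measurable g) {C : ℝ} (hC : ∀ x, |g x| ≤ C) :
    sInt (p.toSignedMeasure - n.toSignedMeasure) g = ∫ x, g x ∂p - ∫ x, g x ∂n := by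
  set ν := p.toSignedMeasure - n.toSignedMeasure with hν
  set P := ν.toJordanDecomposition.posPart with hP
  set N := ν.toJordanDecomposition.negPart with hN
  have h1 : P.toSignedMeasure - N.toSignedMeasure = ν :=
    SignedMeasure.toSignedMeasure_toJordanDecomposition ν
  have h2 : P + n = p + N := by
    rw [← Measure.toSignedMeasure_eq_toSignedMeasure_iff, Measure.toSignedMeasure_add,
      Measure.toSignedMeasure_add]
    have := sub_eq_sub_iff_add_eq_add.1 (h1.trans hν)
    exact this
  have h3 : ∫ x, g x ∂P + ∫ x, g x ∂n = ∫ x, g x ∂p + ∫ x, g x ∂N := by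
    rw [← integral_add_measure (integrable_bdd _ hg hC) (integrable_bdd _ hg hC), h2,
      integral_add_measure (integrable_bdd _ hg hC) (integrable_bdd _ hg hC)]
  unfold sInt
  linarith

noncomputable def tvC {A : Type*} [MeasurableSpace A] (μ : SignedMeasure A) : ℝ :=
  μ.toJordanDecomposition.posPart.real Set.univ + μ.toJordanDecomposition.negPart.real Set.univ

theorem tvC_nonneg {A : Type*} [MeasurableSpace A] (μ : SignedMeasure A) : 0 ≤ tvC μ := by
  unfold tvC; positivity

theorem sInt_diff {A : Type*} [MeasurableSpace A] (μ : SignedMeasure A) {g h : A → ℝ}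
    (hg : Measurable g) (hh : Measurable h) {C D ε : ℝ} (hC : ∀ x, |g x| ≤ C)
    (hD : ∀ x, |h x| ≤ D) (hε : ∀ x, |g x - h x| ≤ ε) :
    |sInt μ g - sInt μ h| ≤ tvC μ * ε := by
  have key : ∀ (p : Measure A) [IsFiniteMeasure p],
      |∫ x, g x ∂p - ∫ x, h x ∂p| ≤ ε * p.real Set.univ := by
    intro p _
    rw [← integral_sub (integrable_bdd _ hg hC) (integrable_bdd _ hh hD)]
    have hε' : ∀ x, ‖g x - h x‖ ≤ ε := hε
    exact norm_integral_le_of_norm_le_const (Filter.Eventually.of_forall hε')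
  have h1 := abs_le.1 (key μ.toJordanDecomposition.posPart)
  have h2 := abs_le.1 (key μ.toJordanDecomposition.negPart)
  unfold sInt tvC
  rw [abs_le]
  constructor <;> nlinarith [h1.1, h1.2, h2.1, h2.2]

theorem exp_dist_abs_le {A : Type*} [MetricSpace A] (x y : A) : |Real.exp (-dist x y)| ≤ 1 := by
  rw [abs_of_pos (Real.exp_pos _), Real.exp_le_one_iff]
  simp

theorem exp_dist_diff {A : Type*} [MetricSpace A] (x y x' y' : A) :
    |Real.exp (-dist x y) - Real.exp (-dist x' y')| ≤ dist x x' + dist y y' := by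
  have aux : ∀ a b : ℝ, 0 ≤ a → 0 ≤ b → Real.exp (-a) - Real.exp (-b) ≤ |a - b| := by
    intro a b ha hb
    have h1 : Real.exp (-b) = Real.exp (-a) * Real.exp (a - b) := by
      rw [← Real.exp_add]; ring_nf
    have h2 := Real.add_one_le_exp (a - b)
    have h3 : Real.exp (-a) ≤ 1 := by simpa using ha
    have h4 := Real.exp_pos (-a)
    have h5 := neg_abs_le (a - b)
    have h6 := abs_nonneg (a - b)
    rw [h1]
    nlinarith
  have hd : |dist x y - dist x' y'| ≤ dist x x' + dist y y' := dist_dist_dist_le x y x' y'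
  rw [abs_le]
  have := aux (dist x y) (dist x' y') dist_nonneg dist_nonneg
  have h' := aux (dist x' y') (dist x y) dist_nonneg dist_nonneg
  rw [abs_sub_comm] at h'
  constructor <;> linarith

section
variable {A : Type*} [MetricSpace A] [CompactSpace A] [MeasurableSpace A] [BorelSpace A]

theorem meas_exp (x : A) : Measurable fun y => Real.exp (-dist x y) :=
  Continuous.measurable (by fun_prop)

theorem pot_meas (μ : SignedMeasure A) :
    Measurable fun x => sInt μ fun y => Real.exp (-dist x y) := by
  apply Continuous.measurable
  apply LipschitzWith.continuous (K := ⟨tvC μ, tvC_nonneg μ⟩)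
  apply LipschitzWith.of_dist_le_mul
  intro x x'
  exact sInt_diff μ (meas_exp x) (meas_exp x') (exp_dist_abs_le x) (exp_dist_abs_le x')
    fun y => by simpa using exp_dist_diff x y x' y

theorem pot_bdd (μ : SignedMeasure A) (x : A) :
    |sInt μ fun y => Real.exp (-dist x y)| ≤ tvC μ * 1 := by
  have := sInt_diff μ (g := fun y => Real.exp (-dist x y)) (h := fun _ => 0) (C := 1) (D := 0)
    (ε := 1) (meas_exp x) measurable_const (exp_dist_abs_le x) (by simp)
    (by simpa using exp_dist_abs_le x)
  simpa [sInt] using this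

theorem push (μ : SignedMeasure A) (K : Set A) (hK : MeasurableSet K) (f : A → A)
    (hf : Measurable f) (ε : ℝ) (hfK : ∀ x, f x ∈ K ∧ dist (f x) x ≤ ε) :
    ∃ ν : SignedMeasure A, ν.totalVariation Kᶜ = 0 ∧ ν Set.univ = μ Set.univ ∧
      |Zform ν ν - Zform μ μ| ≤ tvC μ * (tvC μ * (ε + ε)) := by
  set p := μ.toJordanDecomposition.posPart with hp
  set n := μ.toJordanDecomposition.negPart with hn
  have hμ : p.toSignedMeasure - n.toSignedMeasure = μ :=
    SignedMeasure.toSignedMeasure_toJordanDecomposition μ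
  set ν : SignedMeasure A := (p.map f).toSignedMeasure - (n.map f).toSignedMeasure with hν
  have hpush : ∀ (g : A → ℝ) (C : ℝ), Measurable g → (∀ x, |g x| ≤ C) →
      sInt ν g = sInt μ fun x => g (f x) := by
    intro g C hg hC
    rw [hν, sInt_sub_eq _ _ hg hC, integral_map hf.aemeasurable hg.aestronglyMeasurable,
      integral_map hf.aemeasurable hg.aestronglyMeasurable]
    rfl
  refine ⟨ν, ?_, ?_, ?_⟩
  · have hac : VectorMeasure.AbsolutelyContinuous ν (p.map f + n.map f).toENNRealVectorMeasure := by
      apply VectorMeasure.AbsolutelyContinuous.mk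
      intro s hs h0
      rw [Measure.toENNRealVectorMeasure_apply_measurable hs] at h0
      simp only [Measure.add_apply, add_eq_zero] at h0
      rw [hν, VectorMeasure.sub_apply, Measure.toSignedMeasure_apply_measurable hs,
        Measure.toSignedMeasure_apply_measurable hs]
      simp [Measure.real, h0.1, h0.2]
    rw [SignedMeasure.absolutelyContinuous_ennreal_iff] at hac
    apply hac
    rw [VectorMeasure.ennrealToMeasure_apply hK.compl,
      Measure.toENNRealVectorMeasure_apply_measurable hK.compl, Measure.add_apply,
      Measure.map_apply hf hK.compl, Measure.map_apply hf hK.compl]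
    have : f ⁻¹' Kᶜ = ∅ := by
      ext x; simp [(hfK x).1]
    simp [this]
  · conv_rhs => rw [← hμ]
    rw [hν, VectorMeasure.sub_apply, VectorMeasure.sub_apply,
      Measure.toSignedMeasure_apply_measurable MeasurableSet.univ,
      Measure.toSignedMeasure_apply_measurable MeasurableSet.univ,
      Measure.toSignedMeasure_apply_measurable MeasurableSet.univ,
      Measure.toSignedMeasure_apply_measurable MeasurableSet.univ]
    simp [Measure.real, Measure.map_apply hf MeasurableSet.univ]
  · unfold Zform
    rw [hpush _ _ (pot_meas ν) (pot_bdd ν)]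
    apply sInt_diff μ ((pot_meas ν).comp hf) (pot_meas μ) (fun x => pot_bdd ν (f x)) (pot_bdd μ)
    intro x
    simp only [Function.comp_apply]
    rw [hpush _ 1 (meas_exp (f x)) (exp_dist_abs_le _)]
    apply sInt_diff μ ((meas_exp (f x)).comp hf) (meas_exp x)
      (fun y => exp_dist_abs_le (f x) (f y)) (exp_dist_abs_le x)
    intro y
    exact (exp_dist_diff _ _ _ _).trans (add_le_add (hfK x).2 (hfK y).2)
end

theorem statement7 (A : Type*) [MetricSpace A] [CompactSpace A] [Nonempty A]
    [MeasurableSpace A] [BorelSpace A] (hA : PosDefSpace A)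
    (K : ℕ → Set A) (hKc : ∀ k, IsCompact (K k)) (hKne : ∀ k, (K k).Nonempty)
    (hH : Filter.Tendsto (fun k => hausdorffDist (K k) (Set.univ : Set A))
      Filter.atTop (nhds 0)) :
    Filter.Tendsto (fun k => magnitudeSet (K k)) Filter.atTop
      (nhds (magnitudeSet (Set.univ : Set A))) := by
  rw [tendsto_order]
  constructor
  · intro c hc
    unfold magnitudeSet at hc
    simp only [lt_iSup_iff] at hc
    obtain ⟨μ, ⟨-, hZ⟩, hc⟩ := hc
    have hcont : ContinuousAt (fun z : ℝ => ENNReal.ofReal ((μ Set.univ) ^ 2 / z)) (Zform μ μ) :=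
      ENNReal.continuous_ofReal.continuousAt.comp
        (ContinuousAt.div continuousAt_const continuousAt_id hZ)
    have hev : ∀ᶠ z in nhds (Zform μ μ), c < ENNReal.ofReal ((μ Set.univ) ^ 2 / z) ∧ z ≠ 0 :=
      (hcont.eventually_const_lt hc).and (eventually_ne_nhds hZ)
    obtain ⟨δ, hδ, hball⟩ := Metric.eventually_nhds_iff.1 hev
    have hC := tvC_nonneg μ
    obtain ⟨ε, hε, hεδ⟩ : ∃ ε > 0, tvC μ * (tvC μ * (ε + ε)) < δ := by
      refine ⟨δ / (2 * (tvC μ ^ 2 + 1)), by positivity, ?_⟩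
      have : tvC μ * (tvC μ * (δ / (2 * (tvC μ ^ 2 + 1)) + δ / (2 * (tvC μ ^ 2 + 1))))
          = δ * (tvC μ ^ 2 / (tvC μ ^ 2 + 1)) := by
        field_simp
        ring
      rw [this]
      have h1 : tvC μ ^ 2 / (tvC μ ^ 2 + 1) < 1 := by
        rw [div_lt_one (by positivity)]; linarith
      nlinarith
    filter_upwards [hH.eventually_lt_const hε] with k hk
    have hfin : hausdorffEDist (K k) (Set.univ : Set A) ≠ ⊤ :=
      hausdorffEDist_ne_top_of_nonempty_of_bounded (hKne k) Set.univ_nonempty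
        (hKc k).isBounded isCompact_univ.isBounded
    obtain ⟨f, hf, hfK⟩ := exists_measurable_near (K k) (hKne k) ε fun x => by
      obtain ⟨y, hy, h⟩ := exists_dist_lt_of_hausdorffDist_lt' (Set.mem_univ x) hk hfin
      exact ⟨y, hy, by rwa [dist_comm]⟩
    obtain ⟨ν, h1, h2, h3⟩ := push μ (K k) (hKc k).measurableSet f hf ε hfK
    have h4 := hball (y := Zform ν ν) (lt_of_le_of_lt h3 hεδ)
    refine lt_of_lt_of_le h4.1 ?_
    unfold magnitudeSet
    rw [← h2]
    exact le_iSup₂ (f := fun (μ : SignedMeasure A)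
      (_ : μ.totalVariation (K k)ᶜ = 0 ∧ Zform μ μ ≠ 0) =>
      ENNReal.ofReal ((μ Set.univ) ^ 2 / Zform μ μ)) ν ⟨h1, h4.2⟩
  · intro c hc
    refine Filter.Eventually.of_forall fun k => lt_of_le_of_lt ?_ hc
    unfold magnitudeSet
    refine iSup₂_le fun μ hμ => ?_
    exact le_iSup₂ (f := fun (μ : SignedMeasure A)
      (_ : μ.totalVariation (Set.univ : Set A)ᶜ = 0 ∧ Zform μ μ ≠ 0) =>
      ENNReal.ofReal ((μ Set.univ) ^ 2 / Zform μ μ)) μ ⟨by simp, hμ.2⟩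
end

section
/- Magnitude is continuous with respect to the Gromov–Hausdorff distance on the class of nonempty positively weighted compact positive definite metric spaces: for every nonempty compact positive definite metric space A with |A| = |A|₊ and every ε > 0 there exists δ > 0 such that every nonempty compact positive definite metric space B with |B| = |B|₊ and Gromov–Hausdorff distance d_GH(A,B) < δ satisfies | |B| − |A| | < ε. -/
open MeasureTheory Metric
open scoped ENNReal

/-- The bilinear form `Z_A` on positive measures. -/
noncomputable def Zm {A : Type*} [MetricSpace A] [MeasurableSpace A] (μ ν : Measure A) : ℝ :=
  ∫ x, ∫ y, Real.exp (-dist x y) ∂ν ∂μ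

/-- The maximum diversity of a compact positive definite metric space. -/
noncomputable def maxDivE (A : Type*) [MetricSpace A] [MeasurableSpace A] : ℝ≥0∞ :=
  ⨆ (μ : Measure A) (_ : IsFiniteMeasure μ ∧ μ ≠ 0),
    ENNReal.ofReal ((μ Set.univ).toReal ^ 2 / Zm μ μ)

lemma Zm_eq_prod {A : Type*} [MetricSpace A] [CompactSpace A] [MeasurableSpace A] [BorelSpace A]
    (μ : Measure A) [IsFiniteMeasure μ] :
    Integrable (fun p : A × A => Real.exp (-dist p.1 p.2)) (μ.prod μ) ∧
    Zm μ μ = ∫ p, Real.exp (-dist p.1 p.2) ∂(μ.prod μ) := by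
  have h : Integrable (fun p : A × A => Real.exp (-dist p.1 p.2)) (μ.prod μ) := by
    refine Integrable.of_bound (C := 1) ?_ ?_
    · exact (by fun_prop : Continuous (fun p : A × A => Real.exp (-dist p.1 p.2))).aestronglyMeasurable
    · refine Filter.Eventually.of_forall fun p => ?_
      rw [Real.norm_eq_abs, abs_of_pos (Real.exp_pos _)]
      exact Real.exp_le_one_iff.2 (by simp)
  exact ⟨h, (integral_prod _ h).symm⟩

lemma Zm_lower {A : Type*} [MetricSpace A] [CompactSpace A] [MeasurableSpace A] [BorelSpace A]
    (μ : Measure A) [IsFiniteMeasure μ] :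
    Real.exp (-diam (Set.univ : Set A)) * (μ Set.univ).toReal ^ 2 ≤ Zm μ μ := by
  obtain ⟨h, h2⟩ := Zm_eq_prod μ
  rw [h2]
  have : ∫ p : A × A, Real.exp (-diam (Set.univ : Set A)) ∂(μ.prod μ) ≤
      ∫ p, Real.exp (-dist p.1 p.2) ∂(μ.prod μ) := by
    refine integral_mono (integrable_const _) h fun p => ?_
    refine Real.exp_le_exp.2 (neg_le_neg ?_)
    exact dist_le_diam_of_mem isCompact_univ.isBounded (Set.mem_univ _) (Set.mem_univ _)
  refine le_trans (le_of_eq ?_) this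
  rw [integral_const, Measure.real, ← Set.univ_prod_univ, Measure.prod_prod, ENNReal.toReal_mul,
    smul_eq_mul]
  ring

lemma mass_pos {A : Type*} [MeasurableSpace A]
    (μ : Measure A) [IsFiniteMeasure μ] (h0 : μ ≠ 0) : 0 < (μ Set.univ).toReal :=
  ENNReal.toReal_pos (by simpa using h0) (measure_ne_top _ _)

lemma Zm_pos {A : Type*} [MetricSpace A] [CompactSpace A] [MeasurableSpace A] [BorelSpace A]
    (μ : Measure A) [IsFiniteMeasure μ] (h0 : μ ≠ 0) : 0 < Zm μ μ := by
  have := mass_pos μ h0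
  exact lt_of_lt_of_le (by positivity) (Zm_lower μ)

lemma maxDivE_ne_top (A : Type*) [MetricSpace A] [CompactSpace A] [MeasurableSpace A]
    [BorelSpace A] : maxDivE A ≠ ∞ := by
  refine ne_top_of_le_ne_top (b := ENNReal.ofReal (Real.exp (diam (Set.univ : Set A))))
    ENNReal.ofReal_ne_top ?_
  refine iSup₂_le fun μ hμ => ENNReal.ofReal_le_ofReal ?_
  have := hμ.1
  rw [div_le_iff₀ (Zm_pos μ hμ.2)]
  have := mul_le_mul_of_nonneg_left (Zm_lower μ) (Real.exp_pos (diam (Set.univ : Set A))).le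
  rwa [← mul_assoc, ← Real.exp_add, add_neg_cancel, Real.exp_zero, one_mul] at this

lemma maxDivE_le_of_map {A B : Type*} [MetricSpace A] [CompactSpace A] [MeasurableSpace A]
    [BorelSpace A] [MetricSpace B] [CompactSpace B] [MeasurableSpace B]
    [BorelSpace B] (r : ℝ) (f : B → A) (hf : Measurable f)
    (hd : ∀ x y, dist x y ≤ dist (f x) (f y) + r) :
    maxDivE B ≤ ENNReal.ofReal (Real.exp r) * maxDivE A := by
  refine iSup₂_le fun μ hμ => ?_
  have := hμ.1
  have hne : μ.map f ≠ 0 := by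
    rw [Ne, Measure.map_eq_zero_iff hf.aemeasurable]; exact hμ.2
  have hfin : IsFiniteMeasure (μ.map f) := inferInstance
  have hmass : (μ.map f) Set.univ = μ Set.univ := by
    rw [Measure.map_apply hf MeasurableSet.univ, Set.preimage_univ]
  have hZ : Zm (μ.map f) (μ.map f) ≤ Real.exp r * Zm μ μ := by
    obtain ⟨h1, h2⟩ := Zm_eq_prod (μ.map f)
    obtain ⟨h3, h4⟩ := Zm_eq_prod μ
    rw [h2, h4, ← integral_const_mul]
    rw [Measure.map_prod_map _ _ hf hf] at h1 ⊢
    have hm : Measurable (Prod.map f f) := hf.prodMap hf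
    rw [integral_map hm.aemeasurable h1.aestronglyMeasurable]
    refine integral_mono (h1.comp_measurable hm) (h3.const_mul _) fun p => ?_
    simp only [Prod.map, ← Real.exp_add]
    exact Real.exp_le_exp.2 (by linarith [hd p.1 p.2])
  have hp := Zm_pos (μ.map f) hne
  have hp' := Zm_pos μ hμ.2
  calc ENNReal.ofReal ((μ Set.univ).toReal ^ 2 / Zm μ μ)
      ≤ ENNReal.ofReal (Real.exp r *
          (((μ.map f) Set.univ).toReal ^ 2 / Zm (μ.map f) (μ.map f))) := by
        refine ENNReal.ofReal_le_ofReal ?_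
        rw [hmass, ← mul_div_assoc, div_le_div_iff₀ hp' hp]
        nlinarith [mul_le_mul_of_nonneg_left hZ (sq_nonneg (μ Set.univ).toReal)]
    _ = ENNReal.ofReal (Real.exp r) * ENNReal.ofReal
          (((μ.map f) Set.univ).toReal ^ 2 / Zm (μ.map f) (μ.map f)) :=
        ENNReal.ofReal_mul (Real.exp_pos r).le
    _ ≤ _ := by
        gcongr
        exact le_iSup₂ (f := fun (μ : Measure A) (_ : IsFiniteMeasure μ ∧ μ ≠ 0) =>
          ENNReal.ofReal ((μ Set.univ).toReal ^ 2 / Zm μ μ)) (μ.map f) ⟨hfin, hne⟩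

lemma maxDivE_le_of_embed {A B X : Type*} [MetricSpace A] [CompactSpace A] [MeasurableSpace A]
    [BorelSpace A] [Nonempty A] [MetricSpace B] [CompactSpace B] [MeasurableSpace B]
    [BorelSpace B] [MetricSpace X] (δ : ℝ) (φ : A → X) (ψ : B → X) (hφ : Isometry φ)
    (hψ : Isometry ψ) (h : ∀ b, ∃ a, dist (ψ b) (φ a) < δ) :
    maxDivE B ≤ ENNReal.ofReal (Real.exp (2 * δ)) * maxDivE A := by
  classical
  have hex : ∀ b, ∃ n, dist (ψ b) (φ (TopologicalSpace.denseSeq A n)) < δ := by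
    intro b
    obtain ⟨a, ha⟩ := h b
    have ho : IsOpen {a | dist (ψ b) (φ a) < δ} :=
      isOpen_lt (continuous_const.dist hφ.continuous) continuous_const
    obtain ⟨_, hn, ⟨n, rfl⟩⟩ := (TopologicalSpace.denseRange_denseSeq A).inter_open_nonempty _ ho ⟨a, ha⟩
    exact ⟨n, hn⟩
  have hmeas : Measurable fun b => Nat.find (hex b) := by
    refine measurable_find hex fun n => ?_
    exact (isOpen_lt (hψ.continuous.dist continuous_const) continuous_const).measurableSet
  refine maxDivE_le_of_map (2 * δ) (fun b => TopologicalSpace.denseSeq A (Nat.find (hex b)))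
    ((measurable_from_nat).comp hmeas) fun x y => ?_
  have hx := Nat.find_spec (hex x)
  have hy := Nat.find_spec (hex y)
  rw [← hψ.dist_eq, ← hφ.dist_eq]
  rw [dist_comm (ψ y)] at hy
  have := dist_triangle4 (ψ x) (φ (TopologicalSpace.denseSeq A (Nat.find (hex x))))
    (φ (TopologicalSpace.denseSeq A (Nat.find (hex y)))) (ψ y)
  linarith

lemma maxDivE_toReal_le {A B : Type*} [MetricSpace A] [CompactSpace A] [MeasurableSpace A]
    [BorelSpace A] [MetricSpace B] [MeasurableSpace B] (r : ℝ)
    (h : maxDivE B ≤ ENNReal.ofReal (Real.exp r) * maxDivE A) :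
    (maxDivE B).toReal ≤ Real.exp r * (maxDivE A).toReal := by
  have := ENNReal.toReal_mono (ENNReal.mul_ne_top ENNReal.ofReal_ne_top (maxDivE_ne_top A)) h
  rwa [ENNReal.toReal_mul, ENNReal.toReal_ofReal (Real.exp_pos r).le] at this

theorem statement11 (A : Type) [MetricSpace A] [CompactSpace A] [Nonempty A]
    [MeasurableSpace A] [BorelSpace A] (hA : PosDefSpace A)
    (hpwA : magnitude A = maxDivE A) (ε : ℝ) (hε : 0 < ε) :
    ∃ δ : ℝ, 0 < δ ∧
      ∀ (B : Type) [MetricSpace B] [CompactSpace B] [Nonempty B]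
        [MeasurableSpace B] [BorelSpace B],
        PosDefSpace B → magnitude B = maxDivE B →
          GromovHausdorff.ghDist A B < δ →
            |(magnitude B).toReal - (magnitude A).toReal| < ε := by
  have hM : 0 ≤ (maxDivE A).toReal := ENNReal.toReal_nonneg
  set M := (maxDivE A).toReal with hMdef
  have hc : Continuous fun δ : ℝ => (Real.exp (2 * δ) - 1) * M := by fun_prop
  have hlt : ∀ᶠ δ in nhds (0:ℝ), (Real.exp (2 * δ) - 1) * M < ε := by
    have := hc.tendsto 0
    simp only [mul_zero, Real.exp_zero, sub_self, zero_mul] at this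
    exact this.eventually (gt_mem_nhds hε)
  obtain ⟨δ, hδ, hδ0⟩ :=
    ((hlt.filter_mono nhdsWithin_le_nhds).and
      (self_mem_nhdsWithin : Set.Ioi (0:ℝ) ∈ nhdsWithin 0 (Set.Ioi 0))).exists
  replace hδ0 : 0 < δ := hδ0
  refine ⟨δ, hδ0, fun B _ _ _ _ _ _ hpwB hd => ?_⟩
  rw [hpwA, hpwB]
  obtain ⟨φ, ψ, hφ, hψ, he⟩ := GromovHausdorff.ghDist_eq_hausdorffDist A B
  rw [he] at hd
  have hfin : hausdorffEDist (Set.range φ) (Set.range ψ) ≠ ⊤ :=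
    hausdorffEDist_ne_top_of_nonempty_of_bounded (Set.range_nonempty _) (Set.range_nonempty _)
      (isCompact_range hφ.continuous).isBounded (isCompact_range hψ.continuous).isBounded
  have h1 : maxDivE B ≤ ENNReal.ofReal (Real.exp (2 * δ)) * maxDivE A := by
    refine maxDivE_le_of_embed δ φ ψ hφ hψ fun b => ?_
    obtain ⟨_, ⟨a, rfl⟩, ha⟩ := exists_dist_lt_of_hausdorffDist_lt' (Set.mem_range_self b) hd hfin
    exact ⟨a, by rwa [dist_comm]⟩
  have h2 : maxDivE A ≤ ENNReal.ofReal (Real.exp (2 * δ)) * maxDivE B := by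
    refine maxDivE_le_of_embed δ ψ φ hψ hφ fun a => ?_
    obtain ⟨_, ⟨b, rfl⟩, hb⟩ := exists_dist_lt_of_hausdorffDist_lt (Set.mem_range_self a) hd hfin
    exact ⟨b, hb⟩
  replace h1 := maxDivE_toReal_le _ h1
  replace h2 := maxDivE_toReal_le _ h2
  rw [← hMdef] at h1 h2 ⊢
  have hE : 1 ≤ Real.exp (2 * δ) := Real.one_le_exp (by linarith)
  rw [abs_lt]
  constructor
  · by_contra hcon
    push Not at hcon
    nlinarith
  · linarith
end
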